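/- arXiv:1512.00404 — 2 statements merged into one kernel-verified Lean document; each statement's English description precedes it below -/
import Mathlib

section
/- Let M be a po-Γ-semigroup. The following are equivalent: (1) M is intra-regular; (2) N(x) = {y ∈ M : x ∈ (MΓ{y}ΓM]} for every x ∈ M; (3) 𝒩 = 𝓘, i.e., for all a,b ∈ M, N(a) = N(b) if and only if I(a) = I(b); (4) for every ideal I of M, I = ⋃_{x ∈ I} (x)_𝒩; (5) (x)_𝒩 is a simple subsemigroup of M for every x ∈ M; (6) M is a semilattice of simple semigroups; (7) every ideal of M is semiprime. -/
namespace PGS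

variable {M : Type*} {Γ : Type*}

/-- `AΓB = {aγb : a ∈ A, b ∈ B, γ ∈ Γ}`. -/
def gprod (op : Γ → M → M → M) (A B : Set M) : Set M :=
  {x | ∃ a ∈ A, ∃ b ∈ B, ∃ γ : Γ, x = op γ a b}

/-- `(H] = {t : t ≤ h for some h ∈ H}`. -/
def dcl [PartialOrder M] (H : Set M) : Set M :=
  {t | ∃ h ∈ H, t ≤ h}

/-- `M` with the family of operations `op : Γ → M → M → M` and the partial order `≤`
is a po-Γ-semigroup: `(aγb)μc = aγ(bμc)` and the order is compatible with the operations. -/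
def IsPoGammaSemigroup [PartialOrder M] (op : Γ → M → M → M) : Prop :=
  (∀ (a b c : M) (γ μ : Γ), op μ (op γ a b) c = op γ a (op μ b c)) ∧
  (∀ (a b c : M) (γ : Γ), a ≤ b → op γ a c ≤ op γ b c) ∧
  (∀ (a b c : M) (γ : Γ), a ≤ b → op γ c a ≤ op γ c b)

/-- Left ideal of `M`: `MΓA ⊆ A` and `A` is downward closed. -/
def IsLeftIdeal [PartialOrder M] (op : Γ → M → M → M) (A : Set M) : Prop :=
  gprod op Set.univ A ⊆ A ∧ ∀ a ∈ A, ∀ b : M, b ≤ a → b ∈ A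

/-- Right ideal of `M`: `AΓM ⊆ A` and `A` is downward closed. -/
def IsRightIdeal [PartialOrder M] (op : Γ → M → M → M) (A : Set M) : Prop :=
  gprod op A Set.univ ⊆ A ∧ ∀ a ∈ A, ∀ b : M, b ≤ a → b ∈ A

/-- Ideal of `M`: both a left and a right ideal. -/
def IsIdeal [PartialOrder M] (op : Γ → M → M → M) (A : Set M) : Prop :=
  IsLeftIdeal op A ∧ IsRightIdeal op A

/-- A prime subset: `aγb ∈ T` implies `a ∈ T` or `b ∈ T`. -/
def IsPrimeSubset (op : Γ → M → M → M) (T : Set M) : Prop :=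
  ∀ (a b : M) (γ : Γ), op γ a b ∈ T → a ∈ T ∨ b ∈ T

/-- A semiprime subset: `aγa ∈ T` implies `a ∈ T`. -/
def IsSemiprimeSubset (op : Γ → M → M → M) (T : Set M) : Prop :=
  ∀ (a : M) (γ : Γ), op γ a a ∈ T → a ∈ T

/-- A weakly prime subset: for all ideals `A`, `B` of `M` with `AΓB ⊆ T`,
`A ⊆ T` or `B ⊆ T`. -/
def IsWeaklyPrimeSubset [PartialOrder M] (op : Γ → M → M → M) (T : Set M) : Prop :=
  ∀ A B : Set M, IsIdeal op A → IsIdeal op B → gprod op A B ⊆ T → A ⊆ T ∨ B ⊆ T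

/-- Intra-regular: `x ∈ (MΓ{xγx}ΓM]` for all `x`, `γ`. -/
def IsIntraRegular [PartialOrder M] (op : Γ → M → M → M) : Prop :=
  ∀ (x : M) (γ : Γ),
    x ∈ dcl (gprod op (gprod op Set.univ {op γ x x}) Set.univ)

/-- Left regular: `x ∈ (MΓ{xγx}]` for all `x`, `γ`. -/
def IsLeftRegular [PartialOrder M] (op : Γ → M → M → M) : Prop :=
  ∀ (x : M) (γ : Γ), x ∈ dcl (gprod op Set.univ {op γ x x})

/-- Left duo: every left ideal of `M` is an ideal of `M`. -/
def IsLeftDuo [PartialOrder M] (op : Γ → M → M → M) : Prop :=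
  ∀ A : Set M, IsLeftIdeal op A → IsIdeal op A

/-- A subsemigroup: a nonempty subset `T` with `TΓT ⊆ T`. -/
def IsSubsemigroup (op : Γ → M → M → M) (T : Set M) : Prop :=
  T.Nonempty ∧ gprod op T T ⊆ T

/-- An ideal of a subsemigroup `T`: a nonempty subset `I` of `T` with `TΓI ⊆ I`,
`IΓT ⊆ I`, closed downward inside `T`. -/
def IsIdealOfSub [PartialOrder M] (op : Γ → M → M → M) (T I : Set M) : Prop :=
  I.Nonempty ∧ I ⊆ T ∧ gprod op T I ⊆ I ∧ gprod op I T ⊆ I ∧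
    ∀ a ∈ I, ∀ b ∈ T, b ≤ a → b ∈ I

/-- A left ideal of a subsemigroup `T`: a nonempty subset `I` of `T` with `TΓI ⊆ I`,
closed downward inside `T`. -/
def IsLeftIdealOfSub [PartialOrder M] (op : Γ → M → M → M) (T I : Set M) : Prop :=
  I.Nonempty ∧ I ⊆ T ∧ gprod op T I ⊆ I ∧ ∀ a ∈ I, ∀ b ∈ T, b ≤ a → b ∈ I

/-- A simple subsemigroup: a subsemigroup having no ideal other than itself. -/
def IsSimpleSub [PartialOrder M] (op : Γ → M → M → M) (T : Set M) : Prop :=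
  IsSubsemigroup op T ∧ ∀ I : Set M, IsIdealOfSub op T I → I = T

/-- A left simple subsemigroup: a subsemigroup having no left ideal other than itself. -/
def IsLeftSimpleSub [PartialOrder M] (op : Γ → M → M → M) (T : Set M) : Prop :=
  IsSubsemigroup op T ∧ ∀ I : Set M, IsLeftIdealOfSub op T I → I = T

/-- A filter of `M`: a subsemigroup `F` such that `aγb ∈ F` implies `a ∈ F` and `b ∈ F`,
and `F` is upward closed. -/
def IsFilterSub [PartialOrder M] (op : Γ → M → M → M) (F : Set M) : Prop :=
  IsSubsemigroup op F ∧ (∀ (a b : M) (γ : Γ), op γ a b ∈ F → a ∈ F ∧ b ∈ F) ∧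
    ∀ a ∈ F, ∀ c : M, a ≤ c → c ∈ F

/-- `N(x)`: the least filter of `M` containing `x`. -/
def Nfil [PartialOrder M] (op : Γ → M → M → M) (x : M) : Set M :=
  ⋂₀ {F : Set M | IsFilterSub op F ∧ x ∈ F}

/-- The `𝒩`-class `(x)_𝒩` of `x`, where `a 𝒩 b` iff `N(a) = N(b)`. -/
def Ncls [PartialOrder M] (op : Γ → M → M → M) (x : M) : Set M :=
  {y | Nfil op y = Nfil op x}

/-- `L(a) = ({a} ∪ MΓ{a}]`, the left ideal of `M` generated by `a`. -/
def Lgen [PartialOrder M] (op : Γ → M → M → M) (a : M) : Set M :=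
  dcl ({a} ∪ gprod op Set.univ {a})

/-- `I(a) = ({a} ∪ MΓ{a} ∪ {a}ΓM ∪ MΓ{a}ΓM]`, the ideal of `M` generated by `a`. -/
def Igen [PartialOrder M] (op : Γ → M → M → M) (a : M) : Set M :=
  dcl ({a} ∪ gprod op Set.univ {a} ∪ gprod op {a} Set.univ ∪
    gprod op (gprod op Set.univ {a}) Set.univ)

/-- A semilattice congruence on `M`. -/
def IsSemilatticeCong (op : Γ → M → M → M) (σ : M → M → Prop) : Prop :=
  Equivalence σ ∧
  (∀ (a b c : M) (γ : Γ), σ a b → σ (op γ a c) (op γ b c)) ∧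
  (∀ (a b c : M) (γ : Γ), σ a b → σ (op γ c a) (op γ c b)) ∧
  (∀ (a b : M) (γ : Γ), σ (op γ a b) (op γ b a)) ∧
  (∀ (a : M) (γ : Γ), σ (op γ a a) a)

/-- The `σ`-class of `x`. -/
def cls (σ : M → M → Prop) (x : M) : Set M := {y | σ y x}

/-- `M` is a semilattice of simple semigroups. -/
def IsSemilatticeOfSimple [PartialOrder M] (op : Γ → M → M → M) : Prop :=
  ∃ σ : M → M → Prop, IsSemilatticeCong op σ ∧ ∀ x : M, IsSimpleSub op (cls σ x)

/-- `M` is a semilattice of left simple semigroups. -/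
def IsSemilatticeOfLeftSimple [PartialOrder M] (op : Γ → M → M → M) : Prop :=
  ∃ σ : M → M → Prop, IsSemilatticeCong op σ ∧ ∀ x : M, IsLeftSimpleSub op (cls σ x)

/-- `M` is a chain of simple semigroups. -/
def IsChainOfSimple [PartialOrder M] (op : Γ → M → M → M) : Prop :=
  ∃ σ : M → M → Prop, IsSemilatticeCong op σ ∧ (∀ x : M, IsSimpleSub op (cls σ x)) ∧
    ∀ (x y : M) (γ : Γ), cls σ x = cls σ (op γ x y) ∨ cls σ y = cls σ (op γ x y)


section Auxiliary

variable {op : Γ → M → M → M}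

theorem mem_dcl_gprod_gprod [PartialOrder M] {x y : M} :
    x ∈ dcl (gprod op (gprod op Set.univ {y}) Set.univ) ↔
      ∃ (u v : M) (α β : Γ), x ≤ op β (op α u y) v := by
  constructor
  · rintro ⟨_, ⟨_, ⟨u, -, _, rfl, α, rfl⟩, v, -, β, rfl⟩, h⟩
    exact ⟨u, v, α, β, h⟩
  · rintro ⟨u, v, α, β, h⟩
    exact ⟨_, ⟨_, ⟨u, trivial, y, rfl, α, rfl⟩, v, trivial, β, rfl⟩, h⟩

section Ideal

variable [PartialOrder M] {I : Set M}

theorem IsIdeal.op_left (hI : IsIdeal op I) {a : M} (ha : a ∈ I) (γ : Γ) (c : M) :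
    op γ c a ∈ I :=
  hI.1.1 ⟨c, trivial, a, ha, γ, rfl⟩

theorem IsIdeal.op_right (hI : IsIdeal op I) {a : M} (ha : a ∈ I) (γ : Γ) (c : M) :
    op γ a c ∈ I :=
  hI.2.1 ⟨a, ha, c, trivial, γ, rfl⟩

theorem IsIdeal.mem_of_le (hI : IsIdeal op I) {a b : M} (ha : a ∈ I) (h : b ≤ a) : b ∈ I :=
  hI.1.2 a ha b h

theorem IsPoGammaSemigroup.op_mono (hM : IsPoGammaSemigroup op) {a b c d : M} (γ : Γ)
    (hab : a ≤ b) (hcd : c ≤ d) : op γ a c ≤ op γ b d :=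
  (hM.2.1 a b c γ hab).trans (hM.2.2 c d b γ hcd)

theorem isIdeal_dcl_gprod_gprod (hM : IsPoGammaSemigroup op) (y : M) :
    IsIdeal op (dcl (gprod op (gprod op Set.univ {y}) Set.univ)) := by
  have hdown : ∀ a ∈ dcl (gprod op (gprod op Set.univ {y}) Set.univ), ∀ b : M, b ≤ a →
      b ∈ dcl (gprod op (gprod op Set.univ {y}) Set.univ) :=
    fun _ ⟨h, hh, hah⟩ _ hb => ⟨h, hh, hb.trans hah⟩
  refine ⟨⟨?_, hdown⟩, ⟨?_, hdown⟩⟩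
  · rintro _ ⟨c, -, a, ha, γ, rfl⟩
    obtain ⟨u, v, α, β, h⟩ := mem_dcl_gprod_gprod.1 ha
    refine mem_dcl_gprod_gprod.2 ⟨op γ c u, v, α, β, ?_⟩
    rw [hM.1 c u y γ α, hM.1]
    exact hM.2.2 _ _ _ _ h
  · rintro _ ⟨a, ha, c, -, γ, rfl⟩
    obtain ⟨u, v, α, β, h⟩ := mem_dcl_gprod_gprod.1 ha
    refine mem_dcl_gprod_gprod.2 ⟨u, op γ v c, α, β, ?_⟩
    rw [← hM.1]
    exact hM.2.1 _ _ _ _ h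

theorem self_mem_Igen (a : M) : a ∈ Igen op a :=
  ⟨a, Or.inl (Or.inl (Or.inl rfl)), le_rfl⟩

theorem IsIdeal.Igen_subset (hI : IsIdeal op I) {a : M} (ha : a ∈ I) : Igen op a ⊆ I := by
  rintro t ⟨h, (((rfl | ⟨u, -, _, rfl, α, rfl⟩) | ⟨_, rfl, v, -, β, rfl⟩) |
    ⟨_, ⟨u, -, _, rfl, α, rfl⟩, v, -, β, rfl⟩), hth⟩
  · exact hI.mem_of_le ha hth
  · exact hI.mem_of_le (hI.op_left ha α u) hth
  · exact hI.mem_of_le (hI.op_right ha β v) hth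
  · exact hI.mem_of_le (hI.op_right (hI.op_left ha α u) β v) hth

theorem dcl_gprod_gprod_subset_Igen (a : M) :
    dcl (gprod op (gprod op Set.univ {a}) Set.univ) ⊆ Igen op a :=
  fun _ ⟨h, hh, hth⟩ => ⟨h, Or.inr hh, hth⟩

theorem isIdeal_Igen (hM : IsPoGammaSemigroup op) (a : M) : IsIdeal op (Igen op a) := by
  have hdown : ∀ c ∈ Igen op a, ∀ b : M, b ≤ c → b ∈ Igen op a :=
    fun _ ⟨h, hh, hc⟩ _ hb => ⟨h, hh, hb.trans hc⟩
  have hJ := isIdeal_dcl_gprod_gprod hM a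
  refine ⟨⟨?_, hdown⟩, ⟨?_, hdown⟩⟩
  · rintro _ ⟨c, -, t, ⟨h, hh, hth⟩, γ, rfl⟩
    refine hdown (op γ c h) ?_ _ (hM.2.2 _ _ _ _ hth)
    obtain (((rfl | ⟨u, -, _, rfl, α, rfl⟩) | ⟨_, rfl, v, -, β, rfl⟩) | hh) := hh
    · exact ⟨_, Or.inl (Or.inl (Or.inr ⟨c, trivial, _, rfl, γ, rfl⟩)), le_rfl⟩
    · rw [← hM.1]
      exact ⟨_, Or.inl (Or.inl (Or.inr ⟨_, trivial, _, rfl, α, rfl⟩)), le_rfl⟩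
    · rw [← hM.1]
      exact dcl_gprod_gprod_subset_Igen _ (mem_dcl_gprod_gprod.2 ⟨c, v, γ, β, le_rfl⟩)
    · exact dcl_gprod_gprod_subset_Igen _ (hJ.op_left ⟨h, hh, le_rfl⟩ γ c)
  · rintro _ ⟨t, ⟨h, hh, hth⟩, c, -, γ, rfl⟩
    refine hdown (op γ h c) ?_ _ (hM.2.1 _ _ _ _ hth)
    obtain (((rfl | ⟨u, -, _, rfl, α, rfl⟩) | ⟨_, rfl, v, -, β, rfl⟩) | hh) := hh
    · exact ⟨_, Or.inl (Or.inr ⟨_, rfl, c, trivial, γ, rfl⟩), le_rfl⟩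
    · exact dcl_gprod_gprod_subset_Igen _ (mem_dcl_gprod_gprod.2 ⟨u, c, α, γ, le_rfl⟩)
    · rw [hM.1]
      exact ⟨_, Or.inl (Or.inr ⟨_, rfl, _, trivial, β, rfl⟩), le_rfl⟩
    · exact dcl_gprod_gprod_subset_Igen _ (hJ.op_right ⟨h, hh, le_rfl⟩ γ c)

theorem IsSemiprimeSubset.op_swap_mem (hs : IsSemiprimeSubset op I)
    (hM : IsPoGammaSemigroup op) (hI : IsIdeal op I) {a b : M} {γ : Γ} (h : op γ a b ∈ I)
    (δ : Γ) : op δ b a ∈ I := by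
  refine hs _ γ ?_
  rw [← hM.1, hM.1 b a b δ γ]
  exact hI.op_right (hI.op_left h δ b) δ a

theorem IsSemiprimeSubset.op_op_mem (hs : IsSemiprimeSubset op I)
    (hM : IsPoGammaSemigroup op) (hI : IsIdeal op I) {a b : M} {γ : Γ} (h : op γ a b ∈ I)
    (c : M) (μ ν : Γ) : op ν (op μ a c) b ∈ I := by
  refine hs.op_swap_mem hM hI (γ := γ) ?_ ν
  rw [← hM.1]
  exact hI.op_right (hs.op_swap_mem hM hI h γ) μ c

/-- If all ideals are semiprime, then `w ∈ (MΓ{w}ΓM]` for every `w`. -/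
theorem self_mem_dcl_gprod_gprod [Nonempty Γ] (hM : IsPoGammaSemigroup op)
    (hs : ∀ I : Set M, IsIdeal op I → IsSemiprimeSubset op I) (w : M) :
    w ∈ dcl (gprod op (gprod op Set.univ {w}) Set.univ) := by
  obtain ⟨δ⟩ := ‹Nonempty Γ›
  have hJ := hs _ (isIdeal_dcl_gprod_gprod hM w)
  refine hJ w δ (hJ _ δ (mem_dcl_gprod_gprod.2 ⟨w, op δ w w, δ, δ, le_rfl⟩))

end Ideal

section Filter

variable [PartialOrder M]

theorem IsFilterSub.op_mem_iff {F : Set M} (hF : IsFilterSub op F) {a b : M} {γ : Γ} :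
    op γ a b ∈ F ↔ a ∈ F ∧ b ∈ F :=
  ⟨hF.2.1 a b γ, fun h => hF.1.2 ⟨a, h.1, b, h.2, γ, rfl⟩⟩

theorem mem_Nfil {x y : M} : y ∈ Nfil op x ↔ ∀ F, IsFilterSub op F → x ∈ F → y ∈ F :=
  ⟨fun h F hF hx => h F ⟨hF, hx⟩, fun h F hF => h F hF.1 hF.2⟩

theorem self_mem_Nfil (x : M) : x ∈ Nfil op x := mem_Nfil.2 fun _ _ h => h

theorem Nfil_eq_iff {x y : M} :
    Nfil op x = Nfil op y ↔ ∀ F, IsFilterSub op F → (x ∈ F ↔ y ∈ F) := by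
  constructor
  · intro h F hF
    exact ⟨mem_Nfil.1 (h.symm ▸ self_mem_Nfil y : y ∈ Nfil op x) F hF,
      mem_Nfil.1 (h ▸ self_mem_Nfil x : x ∈ Nfil op y) F hF⟩
  · intro h
    ext z
    simp only [mem_Nfil]
    exact forall₂_congr fun F hF => by rw [h F hF]

theorem Nfil_op_self (a : M) (γ : Γ) : Nfil op (op γ a a) = Nfil op a :=
  Nfil_eq_iff.2 fun F hF => by rw [hF.op_mem_iff, and_self_iff]

theorem isSemilatticeCong_Nfil : IsSemilatticeCong op fun a b => Nfil op a = Nfil op b := by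
  refine ⟨⟨fun _ => rfl, Eq.symm, Eq.trans⟩, fun a b c γ h => ?_, fun a b c γ h => ?_,
    fun a b γ => ?_, Nfil_op_self⟩ <;> refine Nfil_eq_iff.2 fun F hF => ?_
  · rw [hF.op_mem_iff, hF.op_mem_iff, Nfil_eq_iff.1 h F hF]
  · rw [hF.op_mem_iff, hF.op_mem_iff, Nfil_eq_iff.1 h F hF]
  · rw [hF.op_mem_iff, hF.op_mem_iff, and_comm]

theorem isSubsemigroup_Ncls (x : M) : IsSubsemigroup op (Ncls op x) := by
  refine ⟨⟨x, rfl⟩, ?_⟩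
  rintro _ ⟨a, ha, b, hb, γ, rfl⟩
  refine Nfil_eq_iff.2 fun F hF => ?_
  rw [hF.op_mem_iff, Nfil_eq_iff.1 ha F hF, Nfil_eq_iff.1 hb F hF, and_self_iff]

theorem Nfil_eq_of_forall_isSemiprimeSubset [Nonempty Γ] (hM : IsPoGammaSemigroup op)
    (hs : ∀ I : Set M, IsIdeal op I → IsSemiprimeSubset op I) (x : M) :
    Nfil op x = {y : M | x ∈ dcl (gprod op (gprod op Set.univ {y}) Set.univ)} := by
  apply Set.Subset.antisymm
  · refine fun y hy => mem_Nfil.1 hy _ ⟨⟨⟨x, self_mem_dcl_gprod_gprod hM hs x⟩, ?_⟩, ?_, ?_⟩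
      (self_mem_dcl_gprod_gprod hM hs x)
    · rintro _ ⟨y, hy, z, hz, γ, rfl⟩
      obtain ⟨a, b, α, β, hab⟩ := mem_dcl_gprod_gprod.1 hy
      obtain ⟨c, d, α', β', hcd⟩ := mem_dcl_gprod_gprod.1 hz
      have hJ := isIdeal_dcl_gprod_gprod hM (op γ y z)
      have hyz := self_mem_dcl_gprod_gprod hM hs (op γ y z)
      refine hs _ hJ x γ (hJ.mem_of_le ?_ (hM.op_mono γ hab hcd))
      have key := (hs _ hJ).op_op_mem hM hJ hyz (op γ b c) β α'
      have := hJ.op_right (hJ.op_left key α a) β' d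
      simpa only [hM.1] using this
    · intro a b γ h
      obtain ⟨c, d, α, β, h⟩ := mem_dcl_gprod_gprod.1 h
      refine ⟨mem_dcl_gprod_gprod.2 ⟨c, op β b d, α, γ, ?_⟩,
        mem_dcl_gprod_gprod.2 ⟨op α c a, d, γ, β, ?_⟩⟩ <;> simpa only [hM.1] using h
    · intro a ha c hac
      obtain ⟨u, v, α, β, h⟩ := mem_dcl_gprod_gprod.1 ha
      exact mem_dcl_gprod_gprod.2
        ⟨u, v, α, β, h.trans (hM.2.1 _ _ _ _ (hM.2.2 _ _ _ _ hac))⟩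
  · intro y hy
    obtain ⟨u, v, α, β, h⟩ := mem_dcl_gprod_gprod.1 hy
    refine mem_Nfil.2 fun F hF hx => ?_
    exact (hF.op_mem_iff.1 (hF.op_mem_iff.1 (hF.2.2 x hx _ h)).1).2

theorem isSimpleSub_Ncls [Nonempty Γ] (hM : IsPoGammaSemigroup op)
    (hN : ∀ x : M, Nfil op x =
      {y : M | x ∈ dcl (gprod op (gprod op Set.univ {y}) Set.univ)}) (x : M) :
    IsSimpleSub op (Ncls op x) := by
  obtain ⟨γ⟩ := ‹Nonempty Γ›
  refine ⟨isSubsemigroup_Ncls x, ?_⟩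
  rintro I ⟨⟨a, ha⟩, hIK, hl, hr, hdown⟩
  refine hIK.antisymm fun y hy => ?_
  have hya : Nfil op y = Nfil op a := Eq.trans hy (hIK ha).symm
  have hmem : op γ (op γ a a) a ∈ Nfil op y :=
    mem_Nfil.2 fun F hF hyF => by
      have := (Nfil_eq_iff.1 hya F hF).1 hyF
      simp only [hF.op_mem_iff, this, and_self]
  rw [hN y] at hmem
  obtain ⟨u, v, α, β, h⟩ := mem_dcl_gprod_gprod.1 hmem
  have h' : y ≤ op γ (op γ (op α u a) a) (op β a v) := by simpa only [hM.1] using h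
  have hF' : ∀ F, IsFilterSub op F → a ∈ F → op α u a ∈ F ∧ op β a v ∈ F := by
    intro F hF haF
    have := hF.2.2 y ((Nfil_eq_iff.1 hya F hF).2 haF) _ h'
    rw [hF.op_mem_iff, hF.op_mem_iff] at this
    exact ⟨this.1.1, this.2⟩
  have hu : op α u a ∈ Ncls op x := Eq.trans (Nfil_eq_iff.2 fun F hF =>
    ⟨fun h => (hF.op_mem_iff.1 h).2, fun h => (hF' F hF h).1⟩) (hIK ha)
  have hv : op β a v ∈ Ncls op x := Eq.trans (Nfil_eq_iff.2 fun F hF =>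
    ⟨fun h => (hF.op_mem_iff.1 h).1, fun h => (hF' F hF h).2⟩) (hIK ha)
  exact hdown _ (hr ⟨_, hl ⟨_, hu, a, ha, γ, rfl⟩, _, hv, γ, rfl⟩) y hy h'

end Filter

theorem IsSemilatticeOfSimple.isSemiprimeSubset [PartialOrder M]
    (h : IsSemilatticeOfSimple op) {I : Set M} (hI : IsIdeal op I) :
    IsSemiprimeSubset op I := by
  obtain ⟨σ, ⟨hσ, -, -, -, hidem⟩, hsimple⟩ := h
  intro a γ ha
  have hsub := (hsimple a).1
  have heq : I ∩ cls σ a = cls σ a := by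
    refine (hsimple a).2 _ ⟨⟨_, ha, hidem a γ⟩, Set.inter_subset_right, ?_, ?_, ?_⟩
    · rintro _ ⟨c, hc, b, hb, δ, rfl⟩
      exact ⟨hI.op_left hb.1 δ c, hsub.2 ⟨c, hc, b, hb.2, δ, rfl⟩⟩
    · rintro _ ⟨b, hb, c, hc, δ, rfl⟩
      exact ⟨hI.op_right hb.1 δ c, hsub.2 ⟨b, hb.2, c, hc, δ, rfl⟩⟩
    · exact fun b hb c hc hcb => ⟨hI.mem_of_le hb.1 hcb, hc⟩
  exact (heq.symm ▸ hσ.refl a : a ∈ I ∩ cls σ a).1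

end Auxiliary

theorem statement_7 [PartialOrder M] [Nonempty M] [Nonempty Γ]
    (op : Γ → M → M → M) (hM : IsPoGammaSemigroup op) :
    [IsIntraRegular op,
      ∀ x : M, Nfil op x =
        {y : M | x ∈ dcl (gprod op (gprod op Set.univ {y}) Set.univ)},
      ∀ a b : M, Nfil op a = Nfil op b ↔ Igen op a = Igen op b,
      ∀ I : Set M, IsIdeal op I → I = ⋃ x ∈ I, Ncls op x,
      ∀ x : M, IsSimpleSub op (Ncls op x),
      IsSemilatticeOfSimple op,
      ∀ I : Set M, IsIdeal op I → IsSemiprimeSubset op I].TFAE := by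
  tfae_have 1 → 7 := by
    intro h I hI a γ ha
    obtain ⟨u, v, α, β, hle⟩ := mem_dcl_gprod_gprod.1 (h a γ)
    exact hI.mem_of_le (hI.op_right (hI.op_left ha α u) β v) hle
  tfae_have 7 → 1 := fun hs x γ =>
    hs _ (isIdeal_dcl_gprod_gprod hM _) x γ (self_mem_dcl_gprod_gprod hM hs _)
  tfae_have 7 → 2 := fun hs => Nfil_eq_of_forall_isSemiprimeSubset hM hs
  tfae_have 2 → 3 := by
    intro hN
    have hmem : ∀ a b : M, b ∈ Nfil op a ↔
        a ∈ dcl (gprod op (gprod op Set.univ {b}) Set.univ) := fun a b => by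
      rw [hN a, Set.mem_ofPred_eq]
    have hsub : ∀ a b : M, b ∈ Nfil op a ↔ a ∈ Igen op b := fun a b => by
      rw [hmem]
      exact ⟨fun h => dcl_gprod_gprod_subset_Igen b h, fun h =>
        (isIdeal_dcl_gprod_gprod hM b).Igen_subset ((hmem b b).1 (self_mem_Nfil b)) h⟩
    intro a b
    constructor
    · intro h
      exact ((isIdeal_Igen hM b).Igen_subset ((hsub a b).1 (h ▸ self_mem_Nfil b))).antisymm
        ((isIdeal_Igen hM a).Igen_subset ((hsub b a).1 (h ▸ self_mem_Nfil a)))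
    · intro h
      have hb : b ∈ Nfil op a := (hsub a b).2 (h ▸ self_mem_Igen a)
      have ha : a ∈ Nfil op b := (hsub b a).2 (h ▸ self_mem_Igen b)
      exact Nfil_eq_iff.2 fun F hF => ⟨mem_Nfil.1 hb F hF, mem_Nfil.1 ha F hF⟩
  tfae_have 3 → 4 := by
    intro h I hI
    refine Set.Subset.antisymm (fun x hx => Set.mem_biUnion hx rfl)
      (Set.iUnion₂_subset fun x hx y hy => hI.Igen_subset hx ?_)
    exact (h y x).1 hy ▸ self_mem_Igen y
  tfae_have 4 → 7 := by
    intro h I hI a γ ha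
    rw [h I hI]
    exact Set.mem_biUnion ha (Nfil_op_self a γ).symm
  tfae_have 2 → 5 := fun hN => isSimpleSub_Ncls hM hN
  tfae_have 5 → 6 := fun h => ⟨_, isSemilatticeCong_Nfil, h⟩
  tfae_have 6 → 7 := fun h _ hI => h.isSemiprimeSubset hI
  tfae_finish

end PGS
end

section
/- Let M be a po-Γ-semigroup. Every ideal of M is weakly prime if and only if every ideal of M is idempotent and the ideals of M form a chain (i.e., for any two ideals A, B of M, A ⊆ B or B ⊆ A). -/
namespace PGS

variable {M : Type*} {Γ : Type*}

/-- `(AΓB]` is an ideal whenever `A` is a left ideal and `B` is a right ideal. -/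
theorem IsIdeal.dcl_gprod [PartialOrder M] {op : Γ → M → M → M}
    (hM : IsPoGammaSemigroup op) {A B : Set M} (hA : IsLeftIdeal op A) (hB : IsRightIdeal op B) :
    IsIdeal op (dcl (gprod op A B)) := by
  obtain ⟨assoc, mono_left, mono_right⟩ := hM
  have lower : ∀ a ∈ dcl (gprod op A B), ∀ b : M, b ≤ a → b ∈ dcl (gprod op A B) :=
    fun _ ⟨h, hh, hah⟩ _ hba => ⟨h, hh, hba.trans hah⟩
  refine ⟨⟨?_, lower⟩, ⟨?_, lower⟩⟩
  · rintro _ ⟨m, -, t, ⟨_, ⟨a, ha, b, hb, γ, rfl⟩, ht⟩, μ, rfl⟩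
    exact ⟨_, ⟨op μ m a, hA.1 ⟨m, trivial, a, ha, μ, rfl⟩, b, hb, γ, (assoc m a b μ γ).symm⟩,
      mono_right _ _ m μ ht⟩
  · rintro _ ⟨t, ⟨_, ⟨a, ha, b, hb, γ, rfl⟩, ht⟩, m, -, μ, rfl⟩
    exact ⟨_, ⟨a, ha, op μ b m, hB.1 ⟨b, hb, m, trivial, μ, rfl⟩, γ, assoc a b m γ μ⟩,
      mono_left _ _ m μ ht⟩

/-- The intersection of two ideals is an ideal. -/
theorem IsIdeal.inter [PartialOrder M] {op : Γ → M → M → M} {A B : Set M}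
    (hA : IsIdeal op A) (hB : IsIdeal op B) : IsIdeal op (A ∩ B) := by
  have lower : ∀ a ∈ A ∩ B, ∀ b : M, b ≤ a → b ∈ A ∩ B :=
    fun a ha b hba => ⟨hA.1.2 a ha.1 b hba, hB.1.2 a ha.2 b hba⟩
  refine ⟨⟨?_, lower⟩, ⟨?_, lower⟩⟩
  · rintro _ ⟨m, hm, t, ht, γ, rfl⟩
    exact ⟨hA.1.1 ⟨m, hm, t, ht.1, γ, rfl⟩, hB.1.1 ⟨m, hm, t, ht.2, γ, rfl⟩⟩
  · rintro _ ⟨t, ht, m, hm, γ, rfl⟩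
    exact ⟨hA.2.1 ⟨t, ht.1, m, hm, γ, rfl⟩, hB.2.1 ⟨t, ht.2, m, hm, γ, rfl⟩⟩

/-- The product of a right ideal and a left ideal lies in their intersection. -/
theorem gprod_subset_inter [PartialOrder M] {op : Γ → M → M → M} {A B : Set M}
    (hA : IsRightIdeal op A) (hB : IsLeftIdeal op B) : gprod op A B ⊆ A ∩ B := by
  rintro _ ⟨a, ha, b, hb, γ, rfl⟩
  exact ⟨hA.1 ⟨a, ha, b, trivial, γ, rfl⟩, hB.1 ⟨a, trivial, b, hb, γ, rfl⟩⟩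

theorem gprod_nonempty [Nonempty Γ] (op : Γ → M → M → M) {A B : Set M}
    (hA : A.Nonempty) (hB : B.Nonempty) : (gprod op A B).Nonempty := by
  obtain ⟨a, ha⟩ := hA
  obtain ⟨b, hb⟩ := hB
  exact ⟨_, a, ha, b, hb, Classical.arbitrary Γ, rfl⟩

theorem subset_dcl [PartialOrder M] (H : Set M) : H ⊆ dcl H :=
  fun h hh => ⟨h, hh, le_rfl⟩

theorem statement_9 [PartialOrder M] [Nonempty M] [Nonempty Γ]
    (op : Γ → M → M → M) (hM : IsPoGammaSemigroup op) :
    (∀ T : Set M, IsIdeal op T → T.Nonempty →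
        ∀ A B : Set M, IsIdeal op A → A.Nonempty → IsIdeal op B → B.Nonempty →
          gprod op A B ⊆ T → A ⊆ T ∨ B ⊆ T) ↔
      ((∀ A : Set M, IsIdeal op A → A.Nonempty → A = dcl (gprod op A A)) ∧
        (∀ A B : Set M, IsIdeal op A → A.Nonempty → IsIdeal op B → B.Nonempty →
          A ⊆ B ∨ B ⊆ A)) := by
  constructor
  · intro h
    refine ⟨fun A hA hne => ?_, fun A B hA hAne hB hBne => ?_⟩
    · apply Set.Subset.antisymm
      · exact (h _ (IsIdeal.dcl_gprod hM hA.1 hA.2) ((gprod_nonempty op hne hne).mono (subset_dcl _))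
          A A hA hne hA hne (subset_dcl _)).elim id id
      · rintro t ⟨x, hx, htx⟩
        exact hA.1.2 x (gprod_subset_inter hA.2 hA.1 hx).1 t htx
    · have hsub := gprod_subset_inter hA.2 hB.1
      exact (h _ (hA.inter hB) ((gprod_nonempty op hAne hBne).mono hsub) A B hA hAne hB hBne
        hsub).imp (fun H => H.trans Set.inter_subset_right) (fun H => H.trans Set.inter_subset_left)
  · rintro ⟨idem, chain⟩ T hT - A B hA hAne hB hBne hAB
    refine (chain A B hA hAne hB hBne).imp (fun hle x hx => ?_) (fun hle x hx => ?_)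
    · rw [idem A hA hAne] at hx
      obtain ⟨_, ⟨a, ha, b, hb, γ, rfl⟩, hxy⟩ := hx
      exact hT.1.2 _ (hAB ⟨a, ha, b, hle hb, γ, rfl⟩) x hxy
    · rw [idem B hB hBne] at hx
      obtain ⟨_, ⟨a, ha, b, hb, γ, rfl⟩, hxy⟩ := hx
      exact hT.1.2 _ (hAB ⟨a, hle ha, b, hb, γ, rfl⟩) x hxy

end PGS
end
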